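/- arXiv:1803.02435 — 7 statements merged into one kernel-verified Lean document; each statement's English description precedes it below -/
import Mathlib

section
/- Let H be a complex Hilbert space and A_1,…,A_n bounded operators on H with ‖Σ_{k=1}^n A_k*A_k‖ ≤ n and ‖Σ_{k=1}^n A_k A_k*‖ ≤ n, and set C = max_{1≤k≤n} ‖A_k*A_k‖. Let j ≥ 1 and let σ be an equivalence relation (partition) on {1,…,j} with ν(σ) equivalence classes. Then ‖ Σ_{(i_1,…,i_j): ⟨i⟩=σ} A_{i_j}* A_{i_{j−1}}* ⋯ A_{i_1}* A_{i_1} ⋯ A_{i_{j−1}} A_{i_j} ‖ ≤ n^{ν(σ)} · C^{j−ν(σ)}. -/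
open scoped BigOperators Classical

noncomputable section

variable {H : Type*} [NormedAddCommGroup H] [InnerProductSpace ℂ H] [CompleteSpace H]

/-- A sum over tuples whose summand is a function of the `q`-th entry applied to data independent
of that entry can be bounded by summing over the `q`-th entry first. -/
lemma sum_pi_le_of_forall_update {Q β γ : Type*} [Fintype Q] [DecidableEq Q] [Fintype β]
    (q : Q) (W : (Q → β) → γ) (hW : ∀ c d, (∀ p, p ≠ q → c p = d p) → W c = W d)
    (F : β → γ → ℝ) (G : γ → ℝ) (hFG : ∀ y, ∑ k, F k y ≤ Fintype.card β * G y) :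
    ∑ c, F (c q) (W c) ≤ ∑ c, G (W c) := by
  let e := Equiv.funSplitAt q β
  rw [← e.symm.sum_comp, ← e.symm.sum_comp (fun c => G (W c)), Fintype.sum_prod_type_right,
    Fintype.sum_prod_type_right]
  refine Finset.sum_le_sum fun c _ => ?_
  rcases isEmpty_or_nonempty β with hβ | ⟨⟨k₀⟩⟩
  · simp
  have hk : ∀ k, W (e.symm (k, c)) = W (e.symm (k₀, c)) := fun k =>
    hW _ _ fun p hp => by simp [e, Equiv.funSplitAt, Equiv.piSplitAt, hp]
  have hq : ∀ k, e.symm (k, c) q = k := fun k => by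
    simp [e, Equiv.funSplitAt, Equiv.piSplitAt]
  simpa [hk, hq] using hFG (W (e.symm (k₀, c)))

lemma sum_norm_sq_list_prod_le {E Q : Type*} [NormedAddCommGroup E] [NormedSpace ℂ E]
    [Fintype Q] [DecidableEq Q] {n : ℕ} (A : Fin n → E →L[ℂ] E)
    {C : ℝ} (hC₀ : 0 ≤ C) (hC : ∀ k y, ‖A k y‖ ^ 2 ≤ C * ‖y‖ ^ 2)
    (hA : ∀ y, ∑ k, ‖A k y‖ ^ 2 ≤ n * ‖y‖ ^ 2) (L : List Q) (x : E) :
    ∑ c : Q → Fin n, ‖(L.map fun q => A (c q)).prod x‖ ^ 2 ≤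
      (n : ℝ) ^ Fintype.card Q * C ^ (L.length - L.toFinset.card) * ‖x‖ ^ 2 := by
  induction L with
  | nil => simp
  | cons q L ih =>
    simp only [List.map_cons, List.prod_cons, mul_apply_eq_comp]
    by_cases hq : q ∈ L
    · have hcard : (q :: L).length - (q :: L).toFinset.card =
          (L.length - L.toFinset.card) + 1 := by
        have := L.toFinset_card_le
        rw [List.toFinset_cons, Finset.insert_eq_of_mem (List.mem_toFinset.2 hq),
          List.length_cons]
        omega
      rw [hcard]
      calc _ ≤ ∑ c : Q → Fin n, C * ‖(L.map fun q => A (c q)).prod x‖ ^ 2 :=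
            Finset.sum_le_sum fun c _ => hC _ _
        _ = C * ∑ c : Q → Fin n, ‖(L.map fun q => A (c q)).prod x‖ ^ 2 := by
            rw [Finset.mul_sum]
        _ ≤ C * _ := mul_le_mul_of_nonneg_left ih hC₀
        _ = _ := by ring
    · have hcard : (q :: L).length - (q :: L).toFinset.card =
          L.length - L.toFinset.card := by
        rw [List.toFinset_cons, Finset.card_insert_of_notMem (by simpa using hq),
          List.length_cons]
        omega
      rw [hcard]
      refine le_trans ?_ ih
      refine sum_pi_le_of_forall_update q (fun c => (L.map fun q => A (c q)).prod x) ?_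
        (fun k y => ‖A k y‖ ^ 2) (fun y => ‖y‖ ^ 2) (by simpa using hA)
      intro c d hcd
      have : (L.map fun q => A (c q)) = L.map fun q => A (d q) :=
        List.map_congr_left fun p hp => by rw [hcd p (by rintro rfl; exact hq hp)]
      simp only [this]

lemma norm_sum_adjoint_mul_self_le {ι : Type*} (s : Finset ι) (W : ι → H →L[ℂ] H) {M : ℝ}
    (hM : 0 ≤ M) (h : ∀ x, ∑ i ∈ s, ‖W i x‖ ^ 2 ≤ M * ‖x‖ ^ 2) :
    ‖∑ i ∈ s, ContinuousLinearMap.adjoint (W i) * W i‖ ≤ M := by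
  refine ContinuousLinearMap.opNorm_le_bound _ hM fun x => ?_
  set y := (∑ i ∈ s, ContinuousLinearMap.adjoint (W i) * W i) x with hy
  have h₁ : ‖y‖ ^ 2 ≤ ∑ i ∈ s, ‖W i x‖ * ‖W i y‖ := by
    have hz : ∀ z, inner ℂ y z = ∑ i ∈ s, inner ℂ (W i x) (W i z) := fun z => by
      rw [hy, sum_apply, sum_inner]
      simp [ContinuousLinearMap.adjoint_inner_left]
    calc ‖y‖ ^ 2 = ‖inner ℂ y y‖ := by simp
      _ ≤ ∑ i ∈ s, ‖W i x‖ * ‖W i y‖ := by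
        rw [hz]
        exact norm_sum_le_of_le _ fun i _ => norm_inner_le_norm _ _
  have h₂ : (∑ i ∈ s, ‖W i x‖ * ‖W i y‖) ^ 2 ≤ (M * ‖x‖ * ‖y‖) ^ 2 :=
    calc _ ≤ (∑ i ∈ s, ‖W i x‖ ^ 2) * ∑ i ∈ s, ‖W i y‖ ^ 2 :=
          Finset.sum_mul_sq_le_sq_mul_sq _ _ _
      _ ≤ (M * ‖x‖ ^ 2) * (M * ‖y‖ ^ 2) :=
          mul_le_mul (h x) (h y) (by positivity) (by positivity)
      _ = _ := by ring
  have h₃ := h₁.trans (abs_le_of_sq_le_sq' h₂ (by positivity)).2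
  rcases (norm_nonneg y).eq_or_lt with h₀ | h₀
  · rw [← h₀]; positivity
  · exact le_of_mul_le_mul_right (by linarith [sq ‖y‖]) h₀

lemma sum_norm_sq_apply_le {ι : Type*} (s : Finset ι) (A : ι → H →L[ℂ] H) (y : H) :
    ∑ k ∈ s, ‖A k y‖ ^ 2 ≤ ‖∑ k ∈ s, ContinuousLinearMap.adjoint (A k) * A k‖ * ‖y‖ ^ 2 := by
  have h : inner ℂ ((∑ k ∈ s, ContinuousLinearMap.adjoint (A k) * A k) y) y =
      ((∑ k ∈ s, ‖A k y‖ ^ 2 : ℝ) : ℂ) := by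
    rw [sum_apply, sum_inner]
    simp [ContinuousLinearMap.adjoint_inner_left, inner_self_eq_norm_sq_to_K]
  calc ∑ k ∈ s, ‖A k y‖ ^ 2 = ‖((∑ k ∈ s, ‖A k y‖ ^ 2 : ℝ) : ℂ)‖ := by
        rw [Complex.norm_real, Real.norm_of_nonneg (by positivity)]
    _ ≤ ‖(∑ k ∈ s, ContinuousLinearMap.adjoint (A k) * A k) y‖ * ‖y‖ := by
        rw [← h]; exact norm_inner_le_norm _ _
    _ ≤ _ := by
        rw [sq, ← mul_assoc]
        gcongr
        exact ContinuousLinearMap.le_opNorm _ _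

theorem partition_term_norm_bound {n j : ℕ} (hj : 1 ≤ j)
    (A : Fin n → H →L[ℂ] H)
    (h1 : ‖∑ k, ContinuousLinearMap.adjoint (A k) * A k‖ ≤ n)
    (h2 : ‖∑ k, A k * ContinuousLinearMap.adjoint (A k)‖ ≤ n)
    (C : ℝ) (hC : C = ⨆ k, ‖ContinuousLinearMap.adjoint (A k) * A k‖)
    (σ : Setoid (Fin j)) :
    ‖∑ i ∈ Finset.univ.filter
        (fun i : Fin j → Fin n => ∀ a b, i a = i b ↔ σ a b),
        ContinuousLinearMap.adjoint ((List.ofFn fun l => A (i l)).prod) *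
          (List.ofFn fun l => A (i l)).prod‖ ≤
      (n : ℝ) ^ Fintype.card (Quotient σ) * C ^ (j - Fintype.card (Quotient σ)) := by
  have hC₀ : 0 ≤ C := hC ▸ Real.iSup_nonneg fun k => norm_nonneg _
  refine norm_sum_adjoint_mul_self_le _ _ (by positivity) fun x => ?_
  let L : List (Quotient σ) := List.ofFn fun l => Quotient.mk σ l
  have hL : L.toFinset = Finset.univ := by
    ext q
    induction q using Quotient.inductionOn with
    | h a => simp [L, List.mem_ofFn]
  have key := sum_norm_sq_list_prod_le A hC₀
    (fun k y => by
      have hk := sum_norm_sq_apply_le {k} A y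
      simp only [Finset.sum_singleton] at hk
      refine hk.trans ?_
      gcongr
      rw [hC]
      exact le_ciSup (f := fun k => ‖ContinuousLinearMap.adjoint (A k) * A k‖)
        (Set.finite_range _).bddAbove k)
    (fun y => (sum_norm_sq_apply_le _ A y).trans (by gcongr)) L x
  rw [hL, Finset.card_univ, List.length_ofFn] at key
  refine le_trans ?_ key
  let φ : (Quotient σ → Fin n) → Fin j → Fin n := fun c l => c (Quotient.mk σ l)
  have hφ : Function.Injective φ := fun c d hcd => by
    ext q
    induction q using Quotient.inductionOn with
    | h a => exact congrArg Fin.val (congrFun hcd a)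
  have hterm : ∀ c : Quotient σ → Fin n, (L.map fun q => A (c q)) =
      List.ofFn fun l => A (φ c l) := fun c => by
    simp only [L, List.map_ofFn, φ]; rfl
  simp only [hterm]
  rw [← Finset.sum_image (s := Finset.univ) (g := φ)
    (f := fun i => ‖(List.ofFn fun l => A (i l)).prod x‖ ^ 2) hφ.injOn]
  refine Finset.sum_le_sum_of_subset_of_nonneg (fun i hi => ?_) fun _ _ _ => by positivity
  have hi' := (Finset.mem_filter.1 hi).2
  exact Finset.mem_image.2
    ⟨Quotient.lift i fun a b hab => (hi' a b).2 hab, Finset.mem_univ _, rfl⟩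
end
end

section
/- Let H be a complex Hilbert space, ε ≥ 0, and A_1,…,A_n bounded operators on H with ‖(1/n)·Σ_{i=1}^n A_i*A_i − 1‖ ≤ ε. Then for every d ≥ 1, ‖E_wr,d(A) − 1‖ ≤ Σ_{i=1}^{d} ε(1+ε)^{i−1} = (1+ε)^d − 1. -/
open scoped BigOperators

noncomputable section

variable {H : Type*} [NormedAddCommGroup H] [InnerProductSpace ℂ H] [CompleteSpace H]

/-- The ordered product `A_{j_d} ⋯ A_{j_2} A_{j_1}` (composition, leftmost `A_{j_d}`). -/
def ordProd {n d : ℕ} (A : Fin n → H →L[ℂ] H) (j : Fin d → Fin n) : H →L[ℂ] H :=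
  ((List.ofFn fun l => A (j l)).reverse).prod

/-- The with-replacement mean
`E_wr,d(A) = n^{−d} · Σ_{j} A_{j 1}* ⋯ A_{j d}* A_{j d} ⋯ A_{j 1}`. -/
def wrMean (n d : ℕ) (A : Fin n → H →L[ℂ] H) : H →L[ℂ] H :=
  ((n : ℂ) ^ d)⁻¹ •
    ∑ j : Fin d → Fin n, ContinuousLinearMap.adjoint (ordProd A j) * ordProd A j

/-- A self-adjoint element lying between `-r` and `r` has norm at most `r`. -/
theorem IsSelfAdjoint.norm_le_of_neg_le_of_le {R : Type*} [CStarAlgebra R] [PartialOrder R]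
    [StarOrderedRing R] {a : R} {r : ℝ} (ha : IsSelfAdjoint a) (hr : 0 ≤ r)
    (hlow : -algebraMap ℝ R r ≤ a) (hup : a ≤ algebraMap ℝ R r) : ‖a‖ ≤ r := by
  rcases subsingleton_or_nontrivial R with h | h
  · simpa [Subsingleton.elim a 0] using hr
  have hneg : -a ≤ algebraMap ℝ R r := neg_le.mp hlow
  rw [le_algebraMap_iff_spectrum_le ha] at hup
  rw [le_algebraMap_iff_spectrum_le ha.neg] at hneg
  rcases CStarAlgebra.norm_or_neg_norm_mem_spectrum ha with h | h
  · exact hup _ h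
  · refine hneg _ ?_
    rw [← spectrum.neg_eq]
    simpa using h

/-- On self-adjoint elements, the norm of the completely positive map
`x ↦ ∑ i ∈ s, star (B i) * x * B i` is controlled by its value at the identity. -/
theorem IsSelfAdjoint.norm_sum_star_mul_mul_le {R ι : Type*} [CStarAlgebra R] [PartialOrder R]
    [StarOrderedRing R] (s : Finset ι) (B : ι → R) {x : R} (hx : IsSelfAdjoint x) :
    ‖∑ i ∈ s, star (B i) * x * B i‖ ≤ ‖x‖ * ‖∑ i ∈ s, star (B i) * B i‖ := by
  have hsum (r : ℝ) : ∑ i ∈ s, star (B i) * algebraMap ℝ R r * B i =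
      r • ∑ i ∈ s, star (B i) * B i := by
    simp [Algebra.algebraMap_eq_smul_one, Finset.smul_sum]
  have hself : IsSelfAdjoint (∑ i ∈ s, star (B i) * B i) :=
    isSelfAdjoint_sum _ fun i _ => IsSelfAdjoint.star_mul_self (B i)
  have hbound : ‖x‖ • ∑ i ∈ s, star (B i) * B i ≤
      algebraMap ℝ R (‖x‖ * ‖∑ i ∈ s, star (B i) * B i‖) := by
    have h := ((IsSelfAdjoint.all ‖x‖).smul hself).le_algebraMap_norm_self
    rwa [norm_smul, norm_norm] at h
  refine IsSelfAdjoint.norm_le_of_neg_le_of_le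
    (isSelfAdjoint_sum _ fun i _ => hx.conjugate' (B i)) (by positivity) ?_ ?_
  · refine (neg_le_neg hbound).trans ?_
    rw [← hsum, ← Finset.sum_neg_distrib]
    refine Finset.sum_le_sum fun i _ => ?_
    simpa using star_left_conjugate_le_conjugate hx.neg_algebraMap_norm_le_self (B i)
  · refine le_trans ?_ hbound
    rw [← hsum]
    exact Finset.sum_le_sum fun i _ =>
      star_left_conjugate_le_conjugate hx.le_algebraMap_norm_self (B i)

theorem ordProd_cons {E : Type*} [NormedAddCommGroup E] [InnerProductSpace ℂ E] {n d : ℕ}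
    (A : Fin n → E →L[ℂ] E) (a : Fin n) (j : Fin d → Fin n) :
    ordProd A (Fin.cons a j : Fin (d + 1) → Fin n) = ordProd A j * A a := by
  simp [ordProd, List.ofFn_succ]

theorem wrMean_zero (n : ℕ) (A : Fin n → H →L[ℂ] H) : wrMean n 0 A = 1 := by
  simp [wrMean, ordProd, ← ContinuousLinearMap.star_eq_adjoint]

theorem wrMean_succ (n d : ℕ) (A : Fin n → H →L[ℂ] H) :
    wrMean n (d + 1) A = (1 / (n : ℂ)) • ∑ i, star (A i) * wrMean n d A * A i := by
  simp only [wrMean, ← ContinuousLinearMap.star_eq_adjoint]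
  rw [← (Fin.consEquiv fun _ : Fin (d + 1) => Fin n).sum_comp, Fintype.sum_prod_type]
  simp only [Fin.consEquiv, Equiv.coe_fn_mk, ordProd_cons, star_mul, mul_smul_comm,
    smul_mul_assoc, ← Finset.smul_sum, smul_smul, Finset.mul_sum, Finset.sum_mul, mul_assoc]
  congr 1
  rw [pow_succ', mul_inv, one_div]

theorem isSelfAdjoint_wrMean (n d : ℕ) (A : Fin n → H →L[ℂ] H) :
    IsSelfAdjoint (wrMean n d A) := by
  refine IsSelfAdjoint.smul ?_ (isSelfAdjoint_sum _ fun j _ => ?_)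
  · simp [isSelfAdjoint_iff]
  · exact IsSelfAdjoint.star_mul_self (ordProd A j)

theorem wrMean_succ_sub_one (n d : ℕ) (A : Fin n → H →L[ℂ] H) :
    wrMean n (d + 1) A - 1 =
      (1 / (n : ℂ)) • (∑ i, star (A i) * (wrMean n d A - 1) * A i) +
        ((1 / (n : ℂ)) • (∑ i, star (A i) * A i) - 1) := by
  simp [wrMean_succ, mul_sub, sub_mul, smul_sub]

theorem norm_wrMean_sub_one_le {n : ℕ} {ε : ℝ} (A : Fin n → H →L[ℂ] H)
    (hA : ‖(1 / (n : ℂ)) • (∑ i, star (A i) * A i) - (1 : H →L[ℂ] H)‖ ≤ ε) (d : ℕ) :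
    ‖wrMean n d A - 1‖ ≤ (1 + ε) ^ d - 1 := by
  induction d with
  | zero => simp [wrMean_zero]
  | succ d ih =>
    have hone : ‖(1 / (n : ℂ)) • (∑ i, star (A i) * A i)‖ ≤ 1 + ε := by
      calc ‖(1 / (n : ℂ)) • (∑ i, star (A i) * A i)‖
          ≤ ‖(1 : H →L[ℂ] H)‖ + ‖(1 / (n : ℂ)) • (∑ i, star (A i) * A i) - 1‖ :=
            norm_le_norm_add_norm_sub' _ _
        _ ≤ 1 + ε := add_le_add ContinuousLinearMap.norm_id_le hA
    have hmap : ‖(1 / (n : ℂ)) • (∑ i, star (A i) * (wrMean n d A - 1) * A i)‖ ≤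
        ‖wrMean n d A - 1‖ * ‖(1 / (n : ℂ)) • (∑ i, star (A i) * A i)‖ := by
      rw [norm_smul, norm_smul, mul_left_comm]
      gcongr
      exact IsSelfAdjoint.norm_sum_star_mul_mul_le _ _
        ((isSelfAdjoint_wrMean n d A).sub (.one _))
    calc ‖wrMean n (d + 1) A - 1‖
        ≤ ‖wrMean n d A - 1‖ * ‖(1 / (n : ℂ)) • (∑ i, star (A i) * A i)‖ + ε := by
          rw [wrMean_succ_sub_one]
          exact norm_add_le_of_le hmap hA
      _ ≤ ((1 + ε) ^ d - 1) * (1 + ε) + ε := by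
          gcongr
          exact (norm_nonneg _).trans ih
      _ = (1 + ε) ^ (d + 1) - 1 := by ring

theorem wr_mean_deviation {n : ℕ} (ε : ℝ) (hε : 0 ≤ ε)
    (A : Fin n → H →L[ℂ] H)
    (hA : ‖(1 / (n : ℂ)) • (∑ i, ContinuousLinearMap.adjoint (A i) * A i) -
        (1 : H →L[ℂ] H)‖ ≤ ε)
    (d : ℕ) (hd : 1 ≤ d) :
    ‖wrMean n d A - 1‖ ≤ ∑ i ∈ Finset.range d, ε * (1 + ε) ^ i ∧
      ∑ i ∈ Finset.range d, ε * (1 + ε) ^ i = (1 + ε) ^ d - 1 := by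
  have hsum : ∑ i ∈ Finset.range d, ε * (1 + ε) ^ i = (1 + ε) ^ d - 1 := by
    rw [← Finset.mul_sum]
    simpa using mul_geom_sum (1 + ε) d
  exact ⟨hsum ▸ norm_wrMean_sub_one_le A hA d, hsum⟩
end
end

section
/- Let H be a complex Hilbert space, ε ≥ 0, and A_1,…,A_n bounded operators on H with ‖Σ_{i=1}^n A_i*A_i − n·1‖ ≤ nε, and set C = max_{1≤k≤n} ‖A_k*A_k‖. For 1 ≤ d ≤ n define f(d) = Σ_{j=1}^{d} (nε + (1+C)(j−1))/(n−j+1). Then ‖1 − E_wo,d(A)‖ ≤ f(d)·exp(f(d)). -/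
open scoped BigOperators

noncomputable section

variable {H : Type*} [NormedAddCommGroup H] [InnerProductSpace ℂ H] [CompleteSpace H]

/-- The without-replacement mean
`E_wo,d(A) = ((n−d)!/n!) · Σ_{j injective} A_{j 1}* ⋯ A_{j d}* A_{j d} ⋯ A_{j 1}`. -/
def woMean (n d : ℕ) (A : Fin n → H →L[ℂ] H) : H →L[ℂ] H :=
  (((n - d).factorial : ℂ) / (n.factorial : ℂ)) •
    ∑ j ∈ Finset.univ.filter (fun j : Fin d → Fin n => Function.Injective j),
      ContinuousLinearMap.adjoint (ordProd A j) * ordProd A j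

open ContinuousLinearMap in
theorem norm_sum_adjoint_mul_mul_le {ι : Type*} (s : Finset ι) (P S : ι → H →L[ℂ] H) {a : ℝ}
    (ha : 0 ≤ a) (hS : ∀ i ∈ s, ‖S i‖ ≤ a) :
    ‖∑ i ∈ s, adjoint (P i) * S i * P i‖ ≤ a * ‖∑ i ∈ s, adjoint (P i) * P i‖ := by
  set E := ∑ i ∈ s, adjoint (P i) * P i with hE
  have hsq (x : H) (hx : ‖x‖ = 1) : ∑ i ∈ s, ‖P i x‖ ^ 2 ≤ ‖E‖ := by
    have h : ∑ i ∈ s, ‖P i x‖ ^ 2 = RCLike.re (inner ℂ (E x) x) := by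
      simp only [hE, sum_apply, sum_inner, map_sum, mul_apply_eq_comp, adjoint_inner_left,
        inner_self_eq_norm_sq]
    rw [h]
    calc RCLike.re (inner ℂ (E x) x) ≤ ‖E x‖ * ‖x‖ := re_inner_le_norm _ _
      _ ≤ ‖E‖ := by simpa [hx] using E.le_opNorm x
  refine opNorm_le_of_re_inner_le (𝕜 := ℂ) (by positivity) fun x y hx hy ↦ ?_
  calc RCLike.re (inner ℂ ((∑ i ∈ s, adjoint (P i) * S i * P i) x) y)
      = ∑ i ∈ s, RCLike.re (inner ℂ (S i (P i x)) (P i y)) := by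
        simp only [sum_apply, sum_inner, map_sum, mul_apply_eq_comp, adjoint_inner_left]
    _ ≤ ∑ i ∈ s, a * (‖P i x‖ * ‖P i y‖) := by
        refine Finset.sum_le_sum fun i hi ↦ (re_inner_le_norm _ _).trans ?_
        rw [← mul_assoc]
        gcongr
        exact ((S i).le_opNorm _).trans (by gcongr; exact hS i hi)
    _ = a * ∑ i ∈ s, ‖P i x‖ * ‖P i y‖ := (Finset.mul_sum ..).symm
    _ ≤ a * (√(∑ i ∈ s, ‖P i x‖ ^ 2) * √(∑ i ∈ s, ‖P i y‖ ^ 2)) := by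
        gcongr
        exact Real.sum_mul_le_sqrt_mul_sqrt _ _ _
    _ ≤ a * (√‖E‖ * √‖E‖) := by
        gcongr
        exacts [hsq x hx, hsq y hy]
    _ = a * ‖E‖ := by rw [Real.mul_self_sqrt (norm_nonneg _)]

theorem ordProd_snoc {n d : ℕ} (A : Fin n → H →L[ℂ] H) (j : Fin d → Fin n) (k : Fin n) :
    ordProd A (Fin.snoc j k : Fin (d + 1) → Fin n) = A k * ordProd A j := by
  simp [ordProd, List.ofFn_succ', -List.ofFn_succ]

theorem sum_injective_snoc {M : Type*} [AddCommMonoid M] {n d : ℕ}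
    (g : (Fin (d + 1) → Fin n) → M) :
    ∑ j with Function.Injective j, g j =
      ∑ j : Fin d → Fin n with Function.Injective j,
        ∑ k ∈ (Finset.univ.image j)ᶜ, g (Fin.snoc j k) := by
  rw [Finset.sum_filter, Finset.sum_filter,
    ← (Fin.snocEquiv fun _ : Fin (d + 1) ↦ Fin n).sum_comp, Fintype.sum_prod_type_right]
  refine Finset.sum_congr rfl fun j _ ↦ ?_
  have hsnoc (k : Fin n) :
      Fin.snocEquiv (fun _ : Fin (d + 1) ↦ Fin n) (k, j) = Fin.snoc j k := rfl
  simp only [hsnoc, Fin.snoc_injective_iff]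
  split_ifs with h
  · simp only [h, true_and]
    rw [← Finset.sum_filter]
    refine Finset.sum_congr ?_ fun _ _ ↦ rfl
    ext k
    simp
  · simp [h]

theorem woMean_zero (n : ℕ) (A : Fin n → H →L[ℂ] H) : woMean n 0 A = 1 := by
  have h : (n.factorial : ℂ) ≠ 0 := mod_cast n.factorial_ne_zero
  have hadj : ContinuousLinearMap.adjoint (1 : H →L[ℂ] H) = 1 := star_one (H →L[ℂ] H)
  simp [woMean, ordProd, h, hadj, Finset.filter_true_of_mem, Function.injective_of_subsingleton]

open ContinuousLinearMap in
theorem norm_woMean_succ_sub_le {n d : ℕ} (hdn : d < n) {ε : ℝ} (hε : 0 ≤ ε)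
    (A : Fin n → H →L[ℂ] H)
    (hA : ‖(∑ i, adjoint (A i) * A i) - (n : ℂ) • (1 : H →L[ℂ] H)‖ ≤ n * ε)
    {C : ℝ} (hC : ∀ k, ‖adjoint (A k) * A k‖ ≤ C) (hC0 : 0 ≤ C) :
    ‖woMean n (d + 1) A - woMean n d A‖ ≤
      ((n : ℝ) * ε + (1 + C) * d) / ((n : ℝ) - d) * ‖woMean n d A‖ := by
  have hpos : (0 : ℝ) < n - d := sub_pos.2 (mod_cast hdn)
  have hne : (n : ℂ) - d ≠ 0 := sub_ne_zero.2 (mod_cast hdn.ne')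
  have hfac : ((n - d).factorial : ℂ) = (n - d) * ((n - (d + 1)).factorial : ℂ) := by
    rw [← Nat.mul_factorial_pred (Nat.sub_ne_zero_of_lt hdn), Nat.cast_mul, Nat.cast_sub hdn.le,
      Nat.sub_sub]
  let S (j : Fin d → Fin n) : H →L[ℂ] H :=
    ∑ k ∈ (Finset.univ.image j)ᶜ, adjoint (A k) * A k - ((n : ℂ) - d) • 1
  have hS (j) (hj : j ∈ Finset.univ.filter fun j : Fin d → Fin n ↦ Function.Injective j) :
      ‖S j‖ ≤ n * ε + (1 + C) * d := by
    have hcard : (Finset.univ.image j).card = d := by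
      rw [Finset.card_image_of_injective _ (Finset.mem_filter.1 hj).2]
      simp
    have hSj : S j = (∑ i, adjoint (A i) * A i - (n : ℂ) • 1) +
        ((d : ℂ) • 1 - ∑ k ∈ Finset.univ.image j, adjoint (A k) * A k) := by
      rw [← Finset.sum_compl_add_sum (Finset.univ.image j)]
      simp only [S, sub_smul]
      abel
    have hd : ‖(d : ℂ) • (1 : H →L[ℂ] H)‖ ≤ d := by
      rw [norm_smul, Complex.norm_natCast]
      exact mul_le_of_le_one_right (Nat.cast_nonneg _) norm_id_le
    have hsum : ‖∑ k ∈ Finset.univ.image j, adjoint (A k) * A k‖ ≤ d * C := by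
      simpa [hcard] using norm_sum_le_of_le (Finset.univ.image j) fun k _ ↦ hC k
    rw [hSj]
    linarith [norm_add_le_of_le hA (norm_sub_le_of_le hd hsum)]
  have hdiff : woMean n (d + 1) A - woMean n d A =
      (((n - (d + 1)).factorial : ℂ) / n.factorial) •
        ∑ j : Fin d → Fin n with Function.Injective j,
          adjoint (ordProd A j) * S j * ordProd A j := by
    rw [woMean, woMean, hfac, mul_comm ((n : ℂ) - d), mul_div_right_comm, mul_smul, ← smul_sub,
      sum_injective_snoc, Finset.smul_sum, ← Finset.sum_sub_distrib]
    congr 1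
    refine Finset.sum_congr rfl fun j _ ↦ ?_
    have hadj (k) : adjoint (A k * ordProd A j) = adjoint (ordProd A j) * adjoint (A k) :=
      star_mul (A k) (ordProd A j)
    simp only [S, mul_sub, sub_mul, ordProd_snoc, hadj, Finset.mul_sum, Finset.sum_mul, mul_assoc,
      mul_smul_comm, smul_mul_assoc, one_mul]
  have hnorm : ‖woMean n d A‖ = ((n : ℝ) - d) * (‖((n - (d + 1)).factorial : ℂ) / n.factorial‖ *
      ‖∑ j : Fin d → Fin n with Function.Injective j,
        adjoint (ordProd A j) * ordProd A j‖) := by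
    have hcast : ‖(n : ℂ) - d‖ = n - d := by
      rw [← Complex.norm_of_nonneg hpos.le]
      push_cast
      rfl
    rw [woMean, hfac, mul_div_assoc, mul_smul, norm_smul, norm_smul, hcast]
  rw [hdiff, hnorm, ← mul_assoc, div_mul_cancel₀ _ hpos.ne', norm_smul, mul_left_comm]
  gcongr
  exact norm_sum_adjoint_mul_mul_le _ _ _ (by positivity) hS

open ContinuousLinearMap in
theorem norm_one_sub_woMean_le_exp_sub_one {n d : ℕ} (hdn : d ≤ n) {ε : ℝ} (hε : 0 ≤ ε)
    (A : Fin n → H →L[ℂ] H)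
    (hA : ‖(∑ i, adjoint (A i) * A i) - (n : ℂ) • (1 : H →L[ℂ] H)‖ ≤ n * ε)
    {C : ℝ} (hC : ∀ k, ‖adjoint (A k) * A k‖ ≤ C) (hC0 : 0 ≤ C) :
    ‖(1 : H →L[ℂ] H) - woMean n d A‖ ≤
      Real.exp (∑ j ∈ Finset.range d, ((n : ℝ) * ε + (1 + C) * j) / ((n : ℝ) - j)) - 1 := by
  induction d with
  | zero => simp [woMean_zero]
  | succ d ih =>
    specialize ih (by lia)
    rw [Finset.sum_range_succ]
    set F := ∑ j ∈ Finset.range d, ((n : ℝ) * ε + (1 + C) * j) / ((n : ℝ) - j)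
    have hstep := norm_woMean_succ_sub_le (d := d) (by lia) hε A hA hC hC0
    have hpos : (0 : ℝ) < n - d := sub_pos.2 (mod_cast hdn)
    set a := ((n : ℝ) * ε + (1 + C) * d) / ((n : ℝ) - d)
    have ha : 0 ≤ a := by positivity
    have hE : ‖woMean n d A‖ ≤ Real.exp F := by
      have h := norm_sub_le (1 : H →L[ℂ] H) (1 - woMean n d A)
      rw [sub_sub_cancel] at h
      have hone : ‖(1 : H →L[ℂ] H)‖ ≤ 1 := norm_id_le
      linarith
    have htri : ‖(1 : H →L[ℂ] H) - woMean n (d + 1) A‖ ≤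
        ‖1 - woMean n d A‖ + ‖woMean n (d + 1) A - woMean n d A‖ := by
      rw [norm_sub_rev (woMean n (d + 1) A)]
      exact norm_sub_le_norm_sub_add_norm_sub _ _ _
    have hexp : Real.exp F * (a + 1) ≤ Real.exp (F + a) := by
      rw [Real.exp_add]
      gcongr
      exact Real.add_one_le_exp a
    linarith [mul_le_mul_of_nonneg_left hE ha]

theorem wo_mean_deviation {n d : ℕ} (hd : 1 ≤ d) (hdn : d ≤ n)
    (ε : ℝ) (hε : 0 ≤ ε)
    (A : Fin n → H →L[ℂ] H)
    (hA : ‖(∑ i, ContinuousLinearMap.adjoint (A i) * A i) - (n : ℂ) • (1 : H →L[ℂ] H)‖ ≤ n * ε)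
    (C : ℝ) (hC : C = ⨆ k, ‖ContinuousLinearMap.adjoint (A k) * A k‖)
    (f : ℝ)
    (hf : f = ∑ j ∈ Finset.range d, ((n : ℝ) * ε + (1 + C) * j) / ((n : ℝ) - j)) :
    ‖(1 : H →L[ℂ] H) - woMean n d A‖ ≤ f * Real.exp f := by
  have hC' (k : Fin n) : ‖ContinuousLinearMap.adjoint (A k) * A k‖ ≤ C :=
    hC ▸ le_ciSup (f := fun k ↦ ‖ContinuousLinearMap.adjoint (A k) * A k‖)
      (Set.finite_range _).bddAbove k
  have hC0 : 0 ≤ C := hC ▸ Real.iSup_nonneg fun k ↦ norm_nonneg _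
  have h := norm_one_sub_woMean_le_exp_sub_one hdn hε A hA hC' hC0
  rw [← hf] at h
  have hexp : Real.exp f - 1 ≤ f * Real.exp f := by
    have h1 : (-f + 1) * Real.exp f ≤ Real.exp (-f) * Real.exp f := by
      gcongr
      exact Real.add_one_le_exp _
    rw [← Real.exp_add, neg_add_cancel, Real.exp_zero] at h1
    linarith
  exact h.trans hexp
end
end

section
/- For every n ≥ 3 there exist bounded operators a_1,…,a_n on the separable complex Hilbert space ℓ²(ℕ) such that the operator E_wr(a) − E_wo(a) is NOT positive, where E_wo(a) = (1/(n(n−1)(n−2))) · Σ over pairwise distinct triples (j_1,j_2,j_3) in {1,…,n} of a_{j_1} a_{j_2} a_{j_3} a_{j_3}* a_{j_2}* a_{j_1}* and E_wr(a) = n^{−3} · Σ over all triples (j_1,j_2,j_3) ∈ {1,…,n}³ of a_{j_1} a_{j_2} a_{j_3} a_{j_3}* a_{j_2}* a_{j_1}*. In other words, the order inequality E_wo(a) ≤ E_wr(a) (symmetric AGM with constant 1, degree d = 3) fails. -/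
open scoped BigOperators

noncomputable section

/-- The matrix unit sending `e (k + 1)` to `e k`, for a sequence of vectors `e`. -/
def shiftUnit {E : Type*} [NormedAddCommGroup E] [InnerProductSpace ℂ E] (e : ℕ → E) (k : ℕ) :
    E →L[ℂ] E :=
  InnerProductSpace.rankOne ℂ (e k) (e (k + 1))

theorem shiftUnit_apply {E : Type*} [NormedAddCommGroup E] [InnerProductSpace ℂ E]
    {e : ℕ → E} (he : Orthonormal ℂ e) (k m : ℕ) :
    shiftUnit e k (e m) = if m = k + 1 then e k else 0 := by
  rw [shiftUnit, InnerProductSpace.rankOne_apply, orthonormal_iff_ite.mp he]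
  simp [eq_comm]

theorem adjoint_shiftUnit_apply {E : Type*} [NormedAddCommGroup E] [InnerProductSpace ℂ E]
    [CompleteSpace E] {e : ℕ → E} (he : Orthonormal ℂ e) (k m : ℕ) :
    ContinuousLinearMap.adjoint (shiftUnit e k) (e m) = if m = k then e (k + 1) else 0 := by
  rw [shiftUnit, InnerProductSpace.adjoint_rankOne, InnerProductSpace.rankOne_apply,
    orthonormal_iff_ite.mp he]
  simp [eq_comm]

theorem shiftUnit_triple_apply {E : Type*} [NormedAddCommGroup E] [InnerProductSpace ℂ E]
    [CompleteSpace E] {e : ℕ → E} (he : Orthonormal ℂ e) (p q r : ℕ) :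
    ((shiftUnit e p * shiftUnit e q * shiftUnit e r) *
        ContinuousLinearMap.adjoint (shiftUnit e p * shiftUnit e q * shiftUnit e r)) (e 0) =
      if p = 0 ∧ q = 1 ∧ r = 2 then e 0 else 0 := by
  simp only [← ContinuousLinearMap.star_eq_adjoint, star_mul, mul_apply_eq_comp]
  simp only [ContinuousLinearMap.star_eq_adjoint]
  by_cases hp : p = 0
  · subst hp
    by_cases hq : q = 1
    · subst hq
      by_cases hr : r = 2
      · subst hr
        simp [adjoint_shiftUnit_apply he, shiftUnit_apply he]
      · simp [adjoint_shiftUnit_apply he, hr, Ne.symm hr]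
    · simp [adjoint_shiftUnit_apply he, hq, Ne.symm hq]
  · simp [adjoint_shiftUnit_apply he, hp, Ne.symm hp]

theorem orthonormal_lp_single :
    Orthonormal ℂ (fun k : ℕ => (lp.single 2 k (1 : ℂ) : lp (fun _ : ℕ => ℂ) 2)) := by
  rw [orthonormal_iff_ite]
  intro i j
  rw [lp.inner_single_left]
  simp [lp.single_apply, Pi.single_apply]

theorem symmetric_AGM_order_counterexample (n : ℕ) (hn : 3 ≤ n) :
    ∃ a : Fin n → (lp (fun _ : ℕ => ℂ) 2 →L[ℂ] lp (fun _ : ℕ => ℂ) 2),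
      ¬ ContinuousLinearMap.IsPositive
        (((n : ℂ) ^ 3)⁻¹ •
          (∑ j : Fin 3 → Fin n,
            (a (j 0) * a (j 1) * a (j 2)) *
              ContinuousLinearMap.adjoint (a (j 0) * a (j 1) * a (j 2))) -
        ((n : ℂ) * ((n : ℂ) - 1) * ((n : ℂ) - 2))⁻¹ •
          (∑ j ∈ Finset.univ.filter (fun j : Fin 3 → Fin n => Function.Injective j),
            (a (j 0) * a (j 1) * a (j 2)) *
              ContinuousLinearMap.adjoint (a (j 0) * a (j 1) * a (j 2)))) := by
  obtain ⟨e, he⟩ : ∃ e : ℕ → lp (fun _ : ℕ => ℂ) 2, Orthonormal ℂ e :=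
    ⟨_, orthonormal_lp_single⟩
  refine ⟨fun k => shiftUnit e k, fun hpos => ?_⟩
  have h := hpos.re_inner_nonneg_left (e 0)
  have hj (j : Fin 3 → Fin n) :
      ((j 0 : ℕ) = 0 ∧ (j 1 : ℕ) = 1 ∧ (j 2 : ℕ) = 2) ↔ j = Fin.castLE hn := by
    simp [funext_iff, Fin.forall_fin_succ, Fin.ext_iff]
  simp only [sub_apply, smul_apply, sum_apply,
    shiftUnit_triple_apply he, hj, Finset.sum_ite_eq', Finset.mem_univ, Finset.mem_filter,
    true_and, Fin.castLE_injective, if_true] at h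
  rw [← sub_smul, inner_smul_left, inner_self_eq_norm_sq_to_K, he.1 0] at h
  have hn' : (3 : ℝ) ≤ n := by exact_mod_cast hn
  have hlt : ((n : ℝ) ^ 3)⁻¹ < ((n : ℝ) * (n - 1) * (n - 2))⁻¹ := by
    apply inv_strictAnti₀
    · exact mul_pos (mul_pos (by linarith) (by linarith)) (by linarith)
    · nlinarith
  have hcast : ((n : ℂ) ^ 3)⁻¹ - ((n : ℂ) * ((n : ℂ) - 1) * ((n : ℂ) - 2))⁻¹ =
      ((((n : ℝ) ^ 3)⁻¹ - ((n : ℝ) * (n - 1) * (n - 2))⁻¹ : ℝ) : ℂ) := by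
    push_cast
    rfl
  rw [hcast, Complex.conj_ofReal] at h
  simp only [RCLike.ofReal_one, one_pow, mul_one, RCLike.re_to_complex, Complex.ofReal_re] at h
  linarith
end
end

section
/- Let R be a unital ring with involution *, let n ≥ 3, and let a_1,…,a_n, b ∈ R satisfy a_j a_j* = b for every j. Define E_wo = (1/(n(n−1)(n−2))) · Σ over pairwise distinct triples (j_1,j_2,j_3) in {1,…,n} of a_{j_1} a_{j_2} a_{j_3} a_{j_3}* a_{j_2}* a_{j_1}* and E_wr = n^{−3} · Σ over all triples (j_1,j_2,j_3) ∈ {1,…,n}³ of a_{j_1} a_{j_2} a_{j_3} a_{j_3}* a_{j_2}* a_{j_1}*. Then E_wo − E_wr = (1/n² − 1/(n(n−1))) · Σ_{j,k=1}^n a_j a_k (1−b) a_k* a_j* + (1/(n(n−1))) · Σ_{j=1}^n a_j a_j (1−b) a_j* a_j*. -/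
open scoped BigOperators

theorem sum_fin_three_fun {ι M : Type*} [Fintype ι] [AddCommMonoid M]
    (f : ι → ι → ι → M) :
    ∑ j : Fin 3 → ι, f (j 0) (j 1) (j 2) = ∑ x, ∑ y, ∑ z, f x y z := by
  let e : (Fin 3 → ι) ≃ ι × ι × ι :=
    { toFun := fun j => (j 0, j 1, j 2)
      invFun := fun p => ![p.1, p.2.1, p.2.2]
      left_inv := fun j => by
        ext i
        fin_cases i <;> rfl
      right_inv := fun _ => rfl }
  calc
    ∑ j : Fin 3 → ι, f (j 0) (j 1) (j 2) = ∑ p : ι × ι × ι, f p.1 p.2.1 p.2.2 :=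
      e.sum_comp (fun p => f p.1 p.2.1 p.2.2)
    _ = ∑ x, ∑ y, ∑ z, f x y z := by simp only [Fintype.sum_prod_type]

theorem injective_fin_three_iff {ι : Type*} (j : Fin 3 → ι) :
    Function.Injective j ↔ j 0 ≠ j 1 ∧ j 0 ≠ j 2 ∧ j 1 ≠ j 2 := by
  constructor
  · intro h
    exact ⟨h.ne (by decide), h.ne (by decide), h.ne (by decide)⟩
  · rintro ⟨h₀₁, h₀₂, h₁₂⟩ x y hxy
    fin_cases x <;> fin_cases y <;> simp_all

theorem sum_injective_fin_three {ι M : Type*} [Fintype ι] [DecidableEq ι] [AddCommGroup M]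
    [Module ℚ M] (f : ι → ι → M) :
    ∑ j ∈ Finset.univ.filter (fun j : Fin 3 → ι => Function.Injective j), f (j 0) (j 1) =
      ((Fintype.card ι : ℚ) - 2) • (∑ x, ∑ y, f x y - ∑ x, f x x) := by
  have inner_sum (x y : ι) :
      ∑ z, (if x ≠ y ∧ x ≠ z ∧ y ≠ z then f x y else 0) =
        ((Fintype.card ι : ℚ) - 2) • (f x y - if x = y then f x y else 0) := by
    by_cases hxy : x = y
    · simp [hxy]
    · have hz : ∀ z, (if x ≠ y ∧ x ≠ z ∧ y ≠ z then f x y else 0) =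
          f x y - (if x = z then f x y else 0) - (if y = z then f x y else 0) := by
        intro z
        by_cases hx : x = z
        · subst hx
          simp [Ne.symm hxy]
        · by_cases hy : y = z <;> simp [hxy, hx, hy]
      simp only [hz, Finset.sum_sub_distrib, Finset.sum_ite_eq, Finset.mem_univ, if_true,
        Finset.sum_const, Finset.card_univ, hxy, if_false, ← Nat.cast_smul_eq_nsmul ℚ]
      module
  simp only [Finset.sum_filter, injective_fin_three_iff]
  rw [sum_fin_three_fun (fun x y z => if x ≠ y ∧ x ≠ z ∧ y ≠ z then f x y else 0)]
  simp only [inner_sum, ← Finset.smul_sum, Finset.sum_sub_distrib, Finset.sum_ite_eq,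
    Finset.mem_univ, if_true]

theorem wo_wr_difference_identity {R : Type*} [Ring R] [StarRing R] [Algebra ℚ R]
    {n : ℕ} (hn : 3 ≤ n) (a : Fin n → R) (b : R) (hb : ∀ j, a j * star (a j) = b) :
    (((n : ℚ) * ((n : ℚ) - 1) * ((n : ℚ) - 2))⁻¹ •
        ∑ j ∈ Finset.univ.filter (fun j : Fin 3 → Fin n => Function.Injective j),
          (a (j 0) * a (j 1) * a (j 2)) * star (a (j 0) * a (j 1) * a (j 2))) -
      (((n : ℚ) ^ 3)⁻¹ •
        ∑ j : Fin 3 → Fin n,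
          (a (j 0) * a (j 1) * a (j 2)) * star (a (j 0) * a (j 1) * a (j 2))) =
    (1 / (n : ℚ) ^ 2 - 1 / ((n : ℚ) * ((n : ℚ) - 1))) •
        ∑ j : Fin n, ∑ k : Fin n, a j * a k * (1 - b) * star (a k) * star (a j) +
      (1 / ((n : ℚ) * ((n : ℚ) - 1))) •
        ∑ j : Fin n, a j * a j * (1 - b) * star (a j) * star (a j) := by
  let T : Fin n → Fin n → R := fun x y => a x * a y * b * star (a y) * star (a x)
  have word (x y z : Fin n) : (a x * a y * a z) * star (a x * a y * a z) = T x y := by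
    simp only [T, ← hb z, star_mul, mul_assoc]
  have defect (x y : Fin n) :
      a x * a y * (1 - b) * star (a y) * star (a x) = a x * b * star (a x) - T x y := by
    simp only [T, mul_sub, sub_mul, mul_one]
    rw [mul_assoc (a x), hb y]
  have hn' : (3 : ℚ) ≤ n := by exact_mod_cast hn
  have h0 : (n : ℚ) ≠ 0 := by linarith
  have h1 : (n : ℚ) - 1 ≠ 0 := by linarith
  have h2 : (n : ℚ) - 2 ≠ 0 := by linarith
  simp only [word, defect]
  rw [sum_injective_fin_three T, sum_fin_three_fun (fun x y _ => T x y)]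
  simp only [Finset.sum_sub_distrib, Finset.sum_const, Finset.card_univ, Fintype.card_fin,
    ← Nat.cast_smul_eq_nsmul ℚ, ← Finset.smul_sum]
  match_scalars <;> field_simp <;> ring
end

section
/- Let H be a complex Hilbert space, A_1,…,A_n bounded operators on H, and integers 0 ≤ l < k ≤ n. Define S_{l,k}(A) = ((n−k)!/n!) · Σ over all tuples (i_1,…,i_k) of pairwise distinct indices in {1,…,n} of A_{i_k}* ⋯ A_{i_{l+1}}* A_{i_{l+1}} ⋯ A_{i_k}, and C_{k,l} = [n(n−1)⋯(n−l+1)] · [n(n−1)⋯(n−(k−l)+1)] / [n(n−1)⋯(n−k+1)]. Then in the Loewner order, S_{l,k}(A) ≤ C_{k,l} · S_{k−l}(A). -/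
open scoped BigOperators

noncomputable section

variable {H : Type*} [NormedAddCommGroup H] [InnerProductSpace ℂ H] [CompleteSpace H]

/-- The symmetrized without-replacement mean
`S_d(A) = ((n−d)!/n!) · Σ_{j injective} A_{j 1}* ⋯ A_{j d}* A_{j d} ⋯ A_{j 1}`. -/
def symMean (n d : ℕ) (A : Fin n → H →L[ℂ] H) : H →L[ℂ] H :=
  (((n - d).factorial : ℂ) / (n.factorial : ℂ)) •
    ∑ j ∈ Finset.univ.filter (fun j : Fin d → Fin n => Function.Injective j),
      ContinuousLinearMap.adjoint (ordProd A j) * ordProd A j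

/-- The partial mean `S_{l,k}(A)`: the product only involves the indices `i_{l+1},…,i_k`. -/
def partialSymMean (n l k : ℕ) (A : Fin n → H →L[ℂ] H) : H →L[ℂ] H :=
  (((n - k).factorial : ℂ) / (n.factorial : ℂ)) •
    ∑ i ∈ Finset.univ.filter (fun i : Fin k → Fin n => Function.Injective i),
      ContinuousLinearMap.adjoint (((List.ofFn fun m => A (i m)).drop l).prod) *
        ((List.ofFn fun m => A (i m)).drop l).prod

theorem drop_ofFn_eq_reverse_ofFn {α : Type*} {k : ℕ} (l : ℕ) (f : Fin k → α) :
    (List.ofFn f).drop l =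
      (List.ofFn fun b : Fin (k - l) => f ⟨k - 1 - b, by omega⟩).reverse := by
  apply List.ext_getElem
  · simp
  · intro m h₁ h₂
    simp only [List.length_drop, List.length_ofFn] at h₁
    simp only [List.getElem_drop, List.getElem_ofFn, List.getElem_reverse, List.length_ofFn]
    congr 2
    omega

theorem card_filter_injective {n l : ℕ} :
    (Finset.univ.filter (fun j : Fin l → Fin n => Function.Injective j)).card =
      n.descFactorial l := by
  rw [← Fintype.card_subtype, Fintype.card_congr (Equiv.subtypeInjectiveEquivEmbedding _ _)]
  simp

open scoped ComplexOrder in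
theorem factorial_div_nonneg (m n : ℕ) : (0 : ℂ) ≤ m.factorial / n.factorial :=
  div_nonneg (Nat.cast_nonneg _) (Nat.cast_nonneg _)

/-- Splitting an injective tuple into its first `l` entries and its reversed remaining entries
bounds a sum over injective `k`-tuples by one over injective `(k - l)`-tuples. -/
theorem sum_injective_comp_le {M : Type*} [AddCommMonoid M] [PartialOrder M]
    [IsOrderedAddMonoid M] {n l k : ℕ} (hlk : l ≤ k) (f : (Fin (k - l) → Fin n) → M)
    (hf : ∀ j, 0 ≤ f j) :
    ∑ i ∈ Finset.univ.filter (fun i : Fin k → Fin n => Function.Injective i),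
        f (fun b => i ⟨k - 1 - b, by omega⟩) ≤
      n.descFactorial l •
        ∑ j ∈ Finset.univ.filter (fun j : Fin (k - l) → Fin n => Function.Injective j), f j := by
  classical
  let φ : (Fin k → Fin n) → (Fin l → Fin n) × (Fin (k - l) → Fin n) :=
    fun i => (fun a => i (Fin.castLE hlk a), fun b => i ⟨k - 1 - b, by omega⟩)
  have hφ : Function.Injective φ := by
    intro i i' h
    obtain ⟨h₁, h₂⟩ := Prod.ext_iff.1 h
    funext m
    by_cases hm : (m : ℕ) < l
    · exact congrFun h₁ ⟨m, hm⟩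
    · have hm' : (⟨k - 1 - (k - 1 - m), by omega⟩ : Fin k) = m := by
        ext
        simp only
        omega
      have := congrFun h₂ ⟨k - 1 - m, by omega⟩
      simpa only [φ, hm'] using this
  rw [← card_filter_injective, ← Finset.sum_const, ← Finset.sum_product',
    ← Finset.sum_image (f := fun p : (Fin l → Fin n) × (Fin (k - l) → Fin n) => f p.2)
      (g := φ) hφ.injOn]
  refine Finset.sum_le_sum_of_subset_of_nonneg ?_ fun p _ _ => hf p.2
  intro p hp
  obtain ⟨i, hi, rfl⟩ := Finset.mem_image.1 hp
  have hi : Function.Injective i := (Finset.mem_filter.1 hi).2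
  simp only [Finset.mem_product, Finset.mem_filter, Finset.mem_univ, true_and]
  refine ⟨hi.comp (Fin.castLE_injective hlk), fun b b' h => ?_⟩
  have := Fin.ext_iff.1 (hi h)
  simp only at this
  ext
  omega

theorem partial_mean_le_symMean {n l k : ℕ} (hl : 0 ≤ l) (hlk : l < k) (hk : k ≤ n)
    (A : Fin n → H →L[ℂ] H)
    (Ckl : ℝ)
    (hCkl : Ckl = ((n.factorial : ℝ) / (n - l).factorial) *
        ((n.factorial : ℝ) / (n - (k - l)).factorial) /
        ((n.factorial : ℝ) / (n - k).factorial)) :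
    ContinuousLinearMap.IsPositive
      (((Ckl : ℂ) • symMean n (k - l) A) - partialSymMean n l k A) := by
  have h := sum_injective_comp_le hlk.le
    (fun j => ContinuousLinearMap.adjoint (ordProd A j) * ordProd A j)
    fun j => (ContinuousLinearMap.nonneg_iff_isPositive _).2
      (ContinuousLinearMap.isPositive_adjoint_comp_self _)
  have hd : (n.descFactorial l : ℝ) = n.factorial / (n - l).factorial := by
    rw [Nat.descFactorial_eq_div (by omega),
      Nat.cast_div (Nat.factorial_dvd_factorial (Nat.sub_le n l))
        (by exact_mod_cast Nat.factorial_ne_zero _)]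
  have hc : (Ckl : ℂ) * ((n - (k - l)).factorial / n.factorial) =
      ((n - k).factorial / n.factorial) * (n.descFactorial l : ℂ) := by
    have : Ckl * ((n - (k - l)).factorial / n.factorial) =
        ((n - k).factorial / n.factorial) * (n.descFactorial l : ℝ) := by
      rw [hCkl, hd]
      have h₀ : ∀ m : ℕ, (m.factorial : ℝ) ≠ 0 := fun m => by
        exact_mod_cast Nat.factorial_ne_zero m
      field_simp [h₀]
    simpa only [Complex.ofReal_mul, Complex.ofReal_div, Complex.ofReal_natCast] using
      congrArg ((↑) : ℝ → ℂ) this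
  rw [symMean, partialSymMean, smul_smul, hc, mul_smul, ← smul_sub, Nat.cast_smul_eq_nsmul]
  simp only [drop_ofFn_eq_reverse_ofFn]
  exact ((ContinuousLinearMap.le_def _ _).1 h).smul_of_nonneg (factorial_div_nonneg _ _)
end
end

section
/- Let n, k, l be integers with 0 ≤ l ≤ k < n, and define C_{k,l} = (n!/(n−l)!) · (n!/(n−(k−l))!) / (n!/(n−k)!). Then C_{k,k−l} = C_{k,l} and C_{k,l} ≤ (1 + l/(n−k))^{k−l} ≤ exp(l(k−l)/(n−k)). -/
theorem factorial_mul_factorial_mul_pow_le (a l m : ℕ) :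
    (a + m + l).factorial * a.factorial * a ^ m ≤
      (a + m).factorial * (a + l).factorial * (a + l) ^ m := by
  induction m with
  | zero => simp [mul_comm]
  | succ m ih =>
    have h : (a + m + l + 1) * a ≤ (a + m + 1) * (a + l) := by nlinarith [Nat.zero_le (m * l)]
    rw [show a + (m + 1) + l = a + m + l + 1 by ring, ← add_assoc a m 1,
      Nat.factorial_succ, Nat.factorial_succ, pow_succ, pow_succ]
    calc _ = (a + m + l + 1) * a * ((a + m + l).factorial * a.factorial * a ^ m) := by ring
      _ ≤ (a + m + 1) * (a + l) *
          ((a + m).factorial * (a + l).factorial * (a + l) ^ m) := Nat.mul_le_mul h ih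
      _ = _ := by ring

theorem Ckl_symmetry_and_bound {n k l : ℕ} (hl : 0 ≤ l) (hlk : l ≤ k) (hkn : k < n)
    (Ckl : ℕ → ℕ → ℝ)
    (hCkl : ∀ k' l', Ckl k' l' = ((n.factorial : ℝ) / (n - l').factorial) *
        ((n.factorial : ℝ) / (n - (k' - l')).factorial) /
        ((n.factorial : ℝ) / (n - k').factorial)) :
    Ckl k (k - l) = Ckl k l ∧
      Ckl k l ≤ (1 + (l : ℝ) / ((n : ℝ) - k)) ^ (k - l) ∧
      (1 + (l : ℝ) / ((n : ℝ) - k)) ^ (k - l) ≤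
        Real.exp ((l : ℝ) * ((k : ℝ) - l) / ((n : ℝ) - k)) := by
  obtain ⟨m, rfl⟩ := Nat.exists_eq_add_of_le hlk
  obtain ⟨a, rfl⟩ := Nat.exists_eq_add_of_le hkn.le
  have ha : (0 : ℝ) < a := by
    have : 0 < a := by omega
    exact_mod_cast this
  have hcast : ((l + m + a : ℕ) : ℝ) - ((l + m : ℕ) : ℝ) = a := by push_cast; ring
  refine ⟨?_, ?_, ?_⟩
  · rw [hCkl, hCkl, Nat.sub_sub_self hlk, mul_comm ((_ : ℝ) / _)]
  · rw [hCkl, hcast, show l + m - l = m by omega, show l + m + a - l = a + m by omega,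
      show l + m + a - m = a + l by omega, show l + m + a - (l + m) = a by omega,
      show l + m + a = a + m + l by omega]
    have key : ((a + m + l).factorial : ℝ) * a.factorial * (a : ℝ) ^ m ≤
        (a + m).factorial * (a + l).factorial * ((a : ℝ) + l) ^ m := by
      exact_mod_cast factorial_mul_factorial_mul_pow_le a l m
    have h1 : ((a + m + l).factorial : ℝ) ≠ 0 := by positivity
    have h2 : ((a + m).factorial : ℝ) ≠ 0 := by positivity
    have h3 : ((a + l).factorial : ℝ) ≠ 0 := by positivity
    have h4 : (a.factorial : ℝ) ≠ 0 := by positivity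
    calc _ = ((a + m + l).factorial : ℝ) * a.factorial /
          ((a + m).factorial * (a + l).factorial) := by field_simp
      _ ≤ ((a : ℝ) + l) ^ m / (a : ℝ) ^ m := by
        rw [div_le_div_iff₀ (by positivity) (by positivity)]
        linarith
      _ = _ := by rw [← div_pow, add_div, div_self ha.ne']
  · rw [hcast, show l + m - l = m by omega,
      show (l : ℝ) * (((l + m : ℕ) : ℝ) - l) / a = m * (l / a) by push_cast; ring,
      Real.exp_nat_mul]
    gcongr
    rw [add_comm]
    exact Real.add_one_le_exp _
end
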